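/- Interactive communication cannot increase dependence: Let X¹, X², F₁, …, F_r be finite-valued random variables satisfying the Markov chains F_i – (F_{1:i-1}, X¹) – X² for odd i and F_i – (F_{1:i-1}, X²) – X¹ for even i (i.e., I(F_i; X² | F_{1:i-1}, X¹) = 0 for odd i and I(F_i; X¹ | F_{1:i-1}, X²) = 0 for even i). Then I(X¹; X² | F₁, …, F_r) ≤ I(X¹; X²). -/

import Mathlib

open scoped BigOperators
open Finset

noncomputable section

namespace Coord

variable {Ω α β γ : Type*}

/-- `p` is a probability mass function on the finite type `α`. -/
def IsPMF [Fintype α] (p : α → ℝ) : Prop := (∀ a, 0 ≤ p a) ∧ ∑ a, p a = 1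

/-- ℓ¹ (total variation) distance between two functions on a finite type. -/
def l1dist [Fintype α] (p q : α → ℝ) : ℝ := ∑ a, |p a - q a|

/-- The distribution (pushforward pmf) of the random variable `X` defined on the
finite sample space `Ω` carrying the pmf `μ`. -/
def distr [Fintype Ω] [DecidableEq α] (μ : Ω → ℝ) (X : Ω → α) : α → ℝ :=
  fun a => ∑ ω, if X ω = a then μ ω else 0

/-- Shannon entropy (base 2) of a pmf. -/
def entFun [Fintype α] (p : α → ℝ) : ℝ := - ∑ a, p a * Real.logb 2 (p a)

/-- Shannon entropy `H(X)` of a random variable `X` on `(Ω, μ)`. -/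
def H [Fintype Ω] [Fintype α] [DecidableEq α] (μ : Ω → ℝ) (X : Ω → α) : ℝ :=
  entFun (distr μ X)

/-- Conditional entropy `H(X | Z)`. -/
def condEnt [Fintype Ω] [Fintype α] [Fintype γ] [DecidableEq α] [DecidableEq γ]
    (μ : Ω → ℝ) (X : Ω → α) (Z : Ω → γ) : ℝ :=
  H μ (fun ω => (X ω, Z ω)) - H μ Z

/-- Mutual information `I(X; Y)`. -/
def mi [Fintype Ω] [Fintype α] [Fintype β] [DecidableEq α] [DecidableEq β]
    (μ : Ω → ℝ) (X : Ω → α) (Y : Ω → β) : ℝ :=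
  H μ X + H μ Y - H μ (fun ω => (X ω, Y ω))

/-- Conditional mutual information `I(X; Y | Z)`. -/
def cmi [Fintype Ω] [Fintype α] [Fintype β] [Fintype γ]
    [DecidableEq α] [DecidableEq β] [DecidableEq γ]
    (μ : Ω → ℝ) (X : Ω → α) (Y : Ω → β) (Z : Ω → γ) : ℝ :=
  H μ (fun ω => (X ω, Z ω)) + H μ (fun ω => (Y ω, Z ω))
    - H μ (fun ω => (X ω, Y ω, Z ω)) - H μ Z

section

variable [Fintype Ω] [DecidableEq α] [DecidableEq β] [DecidableEq γ]

theorem distr_nonneg {μ : Ω → ℝ} (hμ : ∀ ω, 0 ≤ μ ω) (X : Ω → α) (a : α) :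
    0 ≤ distr μ X a :=
  Finset.sum_nonneg fun ω _ => by split_ifs <;> simp [hμ ω]

theorem distr_apply_pos {μ : Ω → ℝ} (hμ : ∀ ω, 0 ≤ μ ω) (X : Ω → α) {ω : Ω} (hω : 0 < μ ω) :
    0 < distr μ X (X ω) :=
  Finset.sum_pos' (fun ω' _ => by split_ifs <;> simp [hμ ω']) ⟨ω, by simp, by simpa using hω⟩

variable [Fintype α]

theorem sum_distr_pair (μ : Ω → ℝ) (X : Ω → α) (Z : Ω → γ) (z : γ) :
    ∑ x, distr μ (fun ω => (X ω, Z ω)) (x, z) = distr μ Z z := by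
  simp only [distr, Prod.mk.injEq]
  rw [Finset.sum_comm]
  refine Finset.sum_congr rfl fun ω _ => ?_
  by_cases h : Z ω = z <;> simp [h]

theorem sum_distr_mul (μ : Ω → ℝ) (X : Ω → α) (f : α → ℝ) :
    ∑ a, distr μ X a * f a = ∑ ω, μ ω * f (X ω) := by
  simp only [distr, Finset.sum_mul]
  rw [Finset.sum_comm]
  simp [ite_mul]

theorem H_eq_sum (μ : Ω → ℝ) (X : Ω → α) :
    H μ X = -∑ ω, μ ω * Real.logb 2 (distr μ X (X ω)) := by
  rw [H, entFun, sum_distr_mul μ X fun a => Real.logb 2 (distr μ X a)]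

theorem sum_distr (μ : Ω → ℝ) (X : Ω → α) : ∑ a, distr μ X a = ∑ ω, μ ω := by
  simpa using sum_distr_mul μ X fun _ => 1

variable [Fintype β] [Fintype γ]

/-- Entropy depends only on the partition of the sample space induced by the variable. -/
theorem H_congr (μ : Ω → ℝ) (X : Ω → α) (Y : Ω → β)
    (h : ∀ ω ω', X ω = X ω' ↔ Y ω = Y ω') : H μ X = H μ Y := by
  simp only [H_eq_sum, distr, h]

/-- Summing `p(x,z) p(y,z) / p(z)` over all `x, y, z` gives the total mass. -/
theorem sum_condIndep_coupling (μ : Ω → ℝ) (X : Ω → α) (Y : Ω → β) (Z : Ω → γ) :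
    ∑ t : α × β × γ, distr μ (fun ω => (X ω, Z ω)) (t.1, t.2.2) *
      distr μ (fun ω => (Y ω, Z ω)) (t.2.1, t.2.2) / distr μ Z t.2.2 = ∑ ω, μ ω := by
  simp only [Fintype.sum_prod_type]
  rw [Finset.sum_congr rfl fun x _ => Finset.sum_comm, Finset.sum_comm, ← sum_distr μ Z]
  refine Finset.sum_congr rfl fun z _ => ?_
  simp only [← Finset.sum_div, ← Finset.mul_sum, ← Finset.sum_mul, sum_distr_pair]
  exact mul_self_div_self _

theorem cmi_nonneg {μ : Ω → ℝ} (hμ : ∀ ω, 0 ≤ μ ω) (X : Ω → α) (Y : Ω → β) (Z : Ω → γ) :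
    0 ≤ cmi μ X Y Z := by
  set p := distr μ fun ω => (X ω, Y ω, Z ω) with hp
  set q : α × β × γ → ℝ := fun t => distr μ (fun ω => (X ω, Z ω)) (t.1, t.2.2) *
      distr μ (fun ω => (Y ω, Z ω)) (t.2.1, t.2.2) / distr μ Z t.2.2 with hq
  have hq0 (t) : 0 ≤ q t :=
    div_nonneg (mul_nonneg (distr_nonneg hμ _ _) (distr_nonneg hμ _ _)) (distr_nonneg hμ _ _)
  have hratio : ∑ ω, μ ω * (q (X ω, Y ω, Z ω) / p (X ω, Y ω, Z ω)) ≤ ∑ ω, μ ω := by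
    rw [← sum_distr_mul μ (fun ω => (X ω, Y ω, Z ω)) fun t => q t / p t,
      ← sum_condIndep_coupling μ X Y Z]
    refine Finset.sum_le_sum fun t _ => ?_
    change p t * (q t / p t) ≤ q t
    by_cases h : p t = 0
    · simpa [h] using hq0 t
    · rw [mul_div_cancel₀ _ h]
  have hterm (ω) : μ ω * (1 - q (X ω, Y ω, Z ω) / p (X ω, Y ω, Z ω)) ≤
      μ ω * (Real.log (p (X ω, Y ω, Z ω)) + Real.log (distr μ Z (Z ω))
        - Real.log (distr μ (fun ω => (X ω, Z ω)) (X ω, Z ω))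
        - Real.log (distr μ (fun ω => (Y ω, Z ω)) (Y ω, Z ω))) := by
    rcases (hμ ω).eq_or_lt with h | h
    · simp [← h]
    refine mul_le_mul_of_nonneg_left ?_ h.le
    have hxyz := distr_apply_pos hμ (fun ω => (X ω, Y ω, Z ω)) h
    have hxz := distr_apply_pos hμ (fun ω => (X ω, Z ω)) h
    have hyz := distr_apply_pos hμ (fun ω => (Y ω, Z ω)) h
    have hz := distr_apply_pos hμ Z h
    have hqpos : 0 < q (X ω, Y ω, Z ω) := div_pos (mul_pos hxz hyz) hz
    have hlog := Real.log_le_sub_one_of_pos (div_pos hqpos hxyz)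
    rw [Real.log_div hqpos.ne' hxyz.ne', hq, Real.log_div (mul_pos hxz hyz).ne' hz.ne',
      Real.log_mul hxz.ne' hyz.ne'] at hlog
    linarith
  have hsum := Finset.sum_le_sum fun ω (_ : ω ∈ Finset.univ) => hterm ω
  have hcmi : cmi μ X Y Z = (∑ ω, μ ω * (Real.log (p (X ω, Y ω, Z ω)) + Real.log (distr μ Z (Z ω))
        - Real.log (distr μ (fun ω => (X ω, Z ω)) (X ω, Z ω))
        - Real.log (distr μ (fun ω => (Y ω, Z ω)) (Y ω, Z ω)))) / Real.log 2 := by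
    simp only [cmi, H_eq_sum, Real.logb, mul_sub, mul_add, Finset.sum_sub_distrib,
      Finset.sum_add_distrib, ← mul_div_assoc, ← Finset.sum_div, hp]
    ring
  rw [hcmi]
  refine div_nonneg (le_trans ?_ hsum) (Real.log_nonneg (by norm_num))
  simp only [mul_sub, mul_one, Finset.sum_sub_distrib]
  linarith

theorem cmi_comm (μ : Ω → ℝ) (X : Ω → α) (Y : Ω → β) (Z : Ω → γ) :
    cmi μ X Y Z = cmi μ Y X Z := by
  have h := H_congr μ (fun ω => (X ω, Y ω, Z ω)) (fun ω => (Y ω, X ω, Z ω))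
    (by simp only [Prod.mk.injEq]; tauto)
  simp only [cmi, h]
  ring

/-- Conditional mutual information depends on the conditioning variable only through the
partition it induces. -/
theorem cmi_congr_right {δ : Type*} [Fintype δ] [DecidableEq δ] (μ : Ω → ℝ) (X : Ω → α)
    (Y : Ω → β) (Z : Ω → γ) (W : Ω → δ) (h : ∀ ω ω', Z ω = Z ω' ↔ W ω = W ω') :
    cmi μ X Y Z = cmi μ X Y W := by
  simp only [cmi]
  rw [H_congr μ Z W h, H_congr μ (fun ω => (X ω, Z ω)) (fun ω => (X ω, W ω)) (by simp [h]),
    H_congr μ (fun ω => (Y ω, Z ω)) (fun ω => (Y ω, W ω)) (by simp [h]),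
    H_congr μ (fun ω => (X ω, Y ω, Z ω)) (fun ω => (X ω, Y ω, W ω)) (by simp [h])]

/-- Conditioning on a variable with a single value has no effect. -/
theorem cmi_eq_mi_of_subsingleton [Subsingleton γ] {μ : Ω → ℝ} (hμ : IsPMF μ) (X : Ω → α)
    (Y : Ω → β) (Z : Ω → γ) : cmi μ X Y Z = mi μ X Y := by
  have hZ : H μ Z = 0 := by
    have (ω : Ω) : distr μ Z (Z ω) = 1 := by simp [distr, Subsingleton.elim _ (Z ω), hμ.2]
    simp [H_eq_sum, this]
  rw [cmi, mi, hZ,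
    H_congr μ (fun ω => (X ω, Z ω)) X (by simp [eq_iff_true_of_subsingleton]),
    H_congr μ (fun ω => (Y ω, Z ω)) Y (by simp [eq_iff_true_of_subsingleton]),
    H_congr μ (fun ω => (X ω, Y ω, Z ω)) (fun ω => (X ω, Y ω))
      (by simp [eq_iff_true_of_subsingleton]), sub_zero]

/-- Revealing a message `F` with `F – (G, X) – Y` Markov does not increase the conditional mutual
information of `X` and `Y` given `G`. -/
theorem cmi_pair_le_of_markov {δ : Type*} [Fintype δ] [DecidableEq δ] {μ : Ω → ℝ}
    (hμ : ∀ ω, 0 ≤ μ ω) (X : Ω → α) (Y : Ω → β) (F : Ω → δ) (G : Ω → γ)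
    (h : cmi μ F Y (fun ω => (G ω, X ω)) = 0) :
    cmi μ X Y (fun ω => (F ω, G ω)) ≤ cmi μ X Y G := by
  have hpos := cmi_nonneg hμ F Y G
  simp only [cmi] at h hpos ⊢
  rw [H_congr μ (fun ω => (F ω, G ω, X ω)) (fun ω => (X ω, F ω, G ω))
      (by simp only [Prod.mk.injEq]; tauto),
    H_congr μ (fun ω => (Y ω, G ω, X ω)) (fun ω => (X ω, Y ω, G ω))
      (by simp only [Prod.mk.injEq]; tauto),
    H_congr μ (fun ω => (F ω, Y ω, G ω, X ω)) (fun ω => (X ω, Y ω, F ω, G ω))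
      (by simp only [Prod.mk.injEq]; tauto),
    H_congr μ (fun ω => (G ω, X ω)) (fun ω => (X ω, G ω))
      (by simp only [Prod.mk.injEq]; tauto)] at h
  rw [H_congr μ (fun ω => (F ω, Y ω, G ω)) (fun ω => (Y ω, F ω, G ω))
      (by simp only [Prod.mk.injEq]; tauto)] at hpos
  linarith

end

/-- interactive communication cannot increase dependence. Let
`X¹, X², F₁, …, F_r` be finite-valued random variables satisfying the Markov chains
`F_i – (F_{1:i-1}, X¹) – X²` for odd (1-based) `i` and `F_i – (F_{1:i-1}, X²) – X¹` for
even (1-based) `i`. Then `I(X¹; X² | F₁, …, F_r) ≤ I(X¹; X²)`.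
(Lean index `i : Fin r` corresponds to the 1-based index `i + 1`.) -/
theorem interactive_cannot_increase_dependence
    {Ω 𝒳₁ 𝒳₂ : Type} {r : ℕ} {𝓕 : Fin r → Type}
    [Fintype Ω] [DecidableEq Ω]
    [Fintype 𝒳₁] [DecidableEq 𝒳₁] [Fintype 𝒳₂] [DecidableEq 𝒳₂]
    [∀ i, Fintype (𝓕 i)] [∀ i, DecidableEq (𝓕 i)]
    (μ : Ω → ℝ) (hμ : IsPMF μ)
    (X₁ : Ω → 𝒳₁) (X₂ : Ω → 𝒳₂)
    (F : (i : Fin r) → Ω → 𝓕 i)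
    (hodd : ∀ i : Fin r, (i : ℕ) % 2 = 0 →
      cmi μ (F i) X₂
        (fun ω => ((fun j : Fin (i : ℕ) => F ⟨j.1, j.2.trans i.2⟩ ω), X₁ ω)) = 0)
    (heven : ∀ i : Fin r, (i : ℕ) % 2 = 1 →
      cmi μ (F i) X₁
        (fun ω => ((fun j : Fin (i : ℕ) => F ⟨j.1, j.2.trans i.2⟩ ω), X₂ ω)) = 0) :
    cmi μ X₁ X₂ (fun ω => fun i : Fin r => F i ω) ≤ mi μ X₁ X₂ := by
  have key (k : ℕ) (hk : k ≤ r) :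
      cmi μ X₁ X₂ (fun ω => fun j : Fin k => F ⟨j.1, j.2.trans_le hk⟩ ω) ≤ mi μ X₁ X₂ := by
    induction k with
    | zero => exact (cmi_eq_mi_of_subsingleton hμ X₁ X₂ _).le
    | succ k ih =>
      refine le_trans ?_ (ih (by omega))
      rw [cmi_congr_right μ X₁ X₂ _ (fun ω => (F ⟨k, hk⟩ ω,
        fun j : Fin k => F ⟨j.1, j.2.trans hk⟩ ω)) fun ω ω' => by
          simp only [funext_iff, Fin.forall_fin_succ', Prod.mk.injEq]
          exact and_comm]
      rcases Nat.mod_two_eq_zero_or_one k with h | h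
      · exact cmi_pair_le_of_markov hμ.1 _ _ _ _ (hodd ⟨k, hk⟩ h)
      · rw [cmi_comm μ X₁ X₂, cmi_comm μ X₁ X₂]
        exact cmi_pair_le_of_markov hμ.1 _ _ _ _ (heven ⟨k, hk⟩ h)
  exact key r le_rfl

end Coord
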